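/- arXiv:math/0608212 — 2 statements merged into one kernel-verified Lean document; each statement's English description precedes it below -/
import Mathlib

section
/- Let G be a non-elementary hyperbolic group. Then the set of elements of G whose conjugacy class is finite (the FC-center of G) is finite. -/
section Preamble

variable {G : Type*} [Group G]

/-- The word length of `g : G` with respect to the generating set `S`. -/
noncomputable def wordLength (S : Set G) (g : G) : ℕ :=
  sInf {n | ∃ w : List G, (∀ x ∈ w, x ∈ S) ∧ w.length = n ∧ w.prod = g}

/-- The word metric `d(x, y) = |x⁻¹ y|` on the Cayley graph of `G`. -/
noncomputable def wordDist (S : Set G) (x y : G) : ℕ := wordLength S (x⁻¹ * y)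

/-- `S` is a finite generating set of `G` closed under inversion. -/
def IsGenSet (S : Set G) : Prop :=
  S.Finite ∧ (∀ x ∈ S, x⁻¹ ∈ S) ∧ Subgroup.closure S = ⊤

/-- `γ`, restricted to `{0, …, n}`, is a geodesic segment in the Cayley graph. -/
def IsGeodesicSegment (S : Set G) (γ : ℕ → G) (n : ℕ) : Prop :=
  ∀ i j, i ≤ n → j ≤ n → wordDist S (γ i) (γ j) = Nat.dist i j

/-- `r : ℕ → G` is a geodesic ray in the Cayley graph. -/
def IsGeodesicRay (S : Set G) (r : ℕ → G) : Prop :=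
  ∀ i j, wordDist S (r i) (r j) = Nat.dist i j

/-- Every geodesic triangle in the Cayley graph of `G` is `δ`-thin: each side lies in
the `δ`-neighborhood of the union of the other two sides. -/
def IsDeltaHyperbolic (S : Set G) (δ : ℕ) : Prop :=
  ∀ (γ₁ γ₂ γ₃ : ℕ → G) (n₁ n₂ n₃ : ℕ),
    IsGeodesicSegment S γ₁ n₁ → IsGeodesicSegment S γ₂ n₂ → IsGeodesicSegment S γ₃ n₃ →
    γ₁ 0 = γ₃ 0 → γ₁ n₁ = γ₂ 0 → γ₂ n₂ = γ₃ n₃ →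
    ∀ k ≤ n₃, ∃ i, (i ≤ n₁ ∧ wordDist S (γ₃ k) (γ₁ i) ≤ δ) ∨
      (i ≤ n₂ ∧ wordDist S (γ₃ k) (γ₂ i) ≤ δ)

/-- `G` is hyperbolic with respect to `S`: some `δ` makes all triangles `δ`-thin. -/
def IsHyperbolic (S : Set G) : Prop := ∃ δ : ℕ, IsDeltaHyperbolic S δ

/-- `H` is a `K`-quasiconvex subgroup: every geodesic between points of `H`
lies in the `K`-neighborhood of `H`. -/
def IsQuasiconvex (S : Set G) (H : Subgroup G) (K : ℕ) : Prop :=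
  ∀ (γ : ℕ → G) (n : ℕ), IsGeodesicSegment S γ n → γ 0 ∈ H → γ n ∈ H →
    ∀ i ≤ n, ∃ h ∈ H, wordDist S (γ i) h ≤ K

/-- Property (*): there is a set-theoretic section `s : G/H → G` of the coset
projection whose image is a net in `G` for the word metric of `S`. -/
def SatisfiesStar (S : Set G) (H : Subgroup G) : Prop :=
  ∃ s : G ⧸ H → G, (∀ q : G ⧸ H, (QuotientGroup.mk (s q) : G ⧸ H) = q) ∧
    ∃ C : ℕ, ∀ g : G, ∃ q : G ⧸ H, wordDist S g (s q) ≤ C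

/-- A hyperbolic group is elementary if it is finite or has an infinite cyclic
subgroup of finite index. -/
def IsElementary (G : Type*) [Group G] : Prop :=
  Finite G ∨ ∃ H : Subgroup G, IsCyclic H ∧ Infinite H ∧ H.index ≠ 0

end Preamble

section Aux

variable {G : Type*} [Group G] {S : Set G}

theorem wl_le {g : G} (w : List G) (hw : ∀ x ∈ w, x ∈ S) (h : w.prod = g) :
    wordLength S g ≤ w.length :=
  Nat.sInf_le ⟨w, hw, rfl, h⟩

theorem wl_exists (hS : IsGenSet S) (g : G) :
    ∃ w : List G, (∀ x ∈ w, x ∈ S) ∧ w.length = wordLength S g ∧ w.prod = g := by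
  have hne : {n | ∃ w : List G, (∀ x ∈ w, x ∈ S) ∧ w.length = n ∧ w.prod = g}.Nonempty := by
    have hg : g ∈ Subgroup.closure S := by rw [hS.2.2]; trivial
    rw [← Subgroup.mem_toSubmonoid, Subgroup.closure_toSubmonoid] at hg
    obtain ⟨l, hl, hp⟩ := Submonoid.exists_list_of_mem_closure hg
    refine ⟨l.length, l, fun x hx => ?_, rfl, hp⟩
    rcases hl x hx with h | h
    · exact h
    · simpa using hS.2.1 _ h
  exact Nat.sInf_mem hne

theorem wl_one : wordLength S (1 : G) = 0 := by
  have := wl_le (S := S) (g := (1 : G)) [] (by simp) (by simp)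
  simpa using this

theorem wl_mul (hS : IsGenSet S) (g h : G) :
    wordLength S (g * h) ≤ wordLength S g + wordLength S h := by
  obtain ⟨w, hw, hl, hp⟩ := wl_exists hS g
  obtain ⟨v, hv, hl', hp'⟩ := wl_exists hS h
  have := wl_le (S := S) (g := g * h) (w ++ v)
    (by intro x hx; rcases List.mem_append.1 hx with h | h; exacts [hw x h, hv x h])
    (by simp [hp, hp'])
  simp only [List.length_append] at this
  omega

theorem wl_inv_le (hS : IsGenSet S) (g : G) : wordLength S g⁻¹ ≤ wordLength S g := by
  obtain ⟨w, hw, hl, hp⟩ := wl_exists hS g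
  have := wl_le (S := S) (g := g⁻¹) (w.map (·⁻¹)).reverse
    (by
      intro x hx
      simp only [List.mem_reverse, List.mem_map] at hx
      obtain ⟨y, hy, rfl⟩ := hx
      exact hS.2.1 _ (hw y hy))
    (by rw [← hp, List.prod_inv_reverse])
  simp only [List.length_reverse, List.length_map] at this
  omega

theorem wl_inv (hS : IsGenSet S) (g : G) : wordLength S g⁻¹ = wordLength S g :=
  le_antisymm (wl_inv_le hS g) (by simpa using wl_inv_le hS g⁻¹)

theorem wd_self (x : G) : wordDist S x x = 0 := by simp [wordDist, wl_one]

theorem wd_comm (hS : IsGenSet S) (x y : G) : wordDist S x y = wordDist S y x := by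
  unfold wordDist; rw [← wl_inv hS]; simp

theorem wd_tri (hS : IsGenSet S) (x y z : G) :
    wordDist S x z ≤ wordDist S x y + wordDist S y z := by
  unfold wordDist
  have := wl_mul hS (x⁻¹ * y) (y⁻¹ * z)
  simpa [mul_assoc] using this

theorem wd_left (g x y : G) : wordDist S (g * x) (g * y) = wordDist S x y := by
  unfold wordDist; simp [mul_assoc]

theorem ball_finite (hS : IsGenSet S) (n : ℕ) : {g : G | wordDist S 1 g ≤ n}.Finite := by
  have h1 : {l : List G | l.length ≤ n ∧ ∀ x ∈ l, x ∈ S}.Finite := by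
    have := hS.1.to_subtype
    refine ((List.finite_length_le S n).image (List.map Subtype.val)).subset ?_
    rintro l ⟨hl, hx⟩
    refine ⟨l.attach.map fun y => ⟨y.1, hx y.1 y.2⟩, by simpa using hl, ?_⟩
    simp
  refine (h1.image List.prod).subset ?_
  intro g hg
  obtain ⟨w, hw, hl, hp⟩ := wl_exists hS g
  have hg' : wordLength S g ≤ n := by simpa [wordDist] using hg
  exact ⟨w, ⟨by omega, hw⟩, hp⟩

theorem exists_geod (hS : IsGenSet S) (x y : G) :
    ∃ γ : ℕ → G, IsGeodesicSegment S γ (wordDist S x y) ∧ γ 0 = x ∧ γ (wordDist S x y) = y := by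
  obtain ⟨w, hw, hl, hp⟩ := wl_exists hS (x⁻¹ * y)
  change w.length = wordDist S x y at hl
  rw [← hl]
  set γ : ℕ → G := fun i => x * (w.take i).prod with hγ
  have h0 : γ 0 = x := by simp [hγ]
  have hn : γ w.length = y := by simp [hγ, hp]
  have hle : ∀ i j, i ≤ j → j ≤ w.length → wordDist S (γ i) (γ j) ≤ j - i := by
    intro i j hij hj
    have he : (w.take j).prod = (w.take i).prod * ((w.take j).drop i).prod := by
      rw [← List.prod_append]
      congr 1
      conv_lhs => rw [← List.take_append_drop i (w.take j)]
      rw [List.take_take, min_eq_left hij]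
    have : wordDist S (γ i) (γ j) ≤ ((w.take j).drop i).length := by
      refine wl_le _ (fun z hz => hw z (List.mem_of_mem_take (List.mem_of_mem_drop hz))) ?_
      simp only [hγ, he]; group
    simp only [List.length_drop, List.length_take] at this
    omega
  have heq : ∀ i j, i ≤ j → j ≤ w.length → wordDist S (γ i) (γ j) = j - i := by
    intro i j hij hj
    have h1 := hle 0 i (by omega) (by omega)
    have h2 := hle j _ hj le_rfl
    have h3 := hle i j hij hj
    have h4 := wd_tri hS (γ 0) (γ i) (γ w.length)
    have h5 := wd_tri hS (γ i) (γ j) (γ w.length)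
    have h6 : wordDist S (γ 0) (γ w.length) = w.length := by rw [h0, hn, hl]
    omega
  refine ⟨γ, ?_, h0, hn⟩
  intro i j hi hj
  rcases le_total i j with h | h
  · rw [heq i j h hj, Nat.dist_eq_sub_of_le h]
  · rw [wd_comm hS, heq j i h hi, Nat.dist_comm, Nat.dist_eq_sub_of_le h]

/-- Four-point condition. -/
def FP (S : Set G) (D : ℕ) : Prop := ∀ x y z w : G,
  wordDist S x y + wordDist S z w ≤ wordDist S x z + wordDist S y w + D ∨
  wordDist S x y + wordDist S z w ≤ wordDist S x w + wordDist S y z + D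

theorem geod_le {γ : ℕ → G} {n : ℕ} (h : IsGeodesicSegment S γ n) {i j : ℕ} (hij : i ≤ j)
    (hj : j ≤ n) : wordDist S (γ i) (γ j) = j - i := by
  rw [h i j (by omega) hj, Nat.dist_eq_sub_of_le hij]

theorem center (hS : IsGenSet S) {δ : ℕ} (hd : IsDeltaHyperbolic S δ) {x y : G} {γ : ℕ → G}
    {n : ℕ} (hγ : IsGeodesicSegment S γ n) (h0 : γ 0 = x) (hn : γ n = y) (z : G) :
    ∃ k ≤ n, wordDist S x (γ k) + wordDist S (γ k) z ≤ wordDist S x z + 2 * δ + 2 ∧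
      wordDist S z (γ k) + wordDist S (γ k) y ≤ wordDist S z y + 2 * δ + 2 := by
  obtain ⟨γ₁, hg1, h10, h1n⟩ := exists_geod hS x z
  obtain ⟨γ₂, hg2, h20, h2n⟩ := exists_geod hS z y
  have key : ∀ k ≤ n, wordDist S x (γ k) + wordDist S (γ k) z ≤ wordDist S x z + 2 * δ ∨
      wordDist S z (γ k) + wordDist S (γ k) y ≤ wordDist S z y + 2 * δ := by
    intro k hk
    obtain ⟨i, ⟨hi, hh⟩ | ⟨hi, hh⟩⟩ := hd γ₁ γ₂ γ _ _ n hg1 hg2 hγ (by rw [h10, h0])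
      (by rw [h1n, h20]) (by rw [h2n, hn]) k hk
    · left
      have e1 := geod_le hg1 (Nat.zero_le i) hi
      have e2 := geod_le hg1 hi le_rfl
      rw [h10] at e1; rw [h1n] at e2
      have := wd_tri hS x (γ₁ i) (γ k)
      have := wd_tri hS (γ k) (γ₁ i) z
      have := wd_comm hS (γ k) (γ₁ i)
      omega
    · right
      have e1 := geod_le hg2 (Nat.zero_le i) hi
      have e2 := geod_le hg2 hi le_rfl
      rw [h20] at e1; rw [h2n] at e2
      have := wd_tri hS z (γ₂ i) (γ k)
      have := wd_tri hS (γ k) (γ₂ i) y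
      have := wd_comm hS (γ k) (γ₂ i)
      omega
  classical
  have hex : ∃ k, k ≤ n ∧ wordDist S z (γ k) + wordDist S (γ k) y ≤ wordDist S z y + 2 * δ :=
    ⟨n, le_rfl, by rw [hn, wd_self]; omega⟩
  obtain ⟨hk, hq⟩ := Nat.find_spec hex
  have hmin := fun m => Nat.find_min hex (m := m)
  generalize Nat.find hex = k at hk hq hmin
  refine ⟨k, hk, ?_, by omega⟩
  rcases Nat.eq_zero_or_pos k with rfl | hpos
  · rw [h0, wd_self]; omega
  · have h1 := key (k - 1) (by omega)
    have h2 := hmin (k - 1) (by omega)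
    have h3 : wordDist S x (γ (k-1)) + wordDist S (γ (k-1)) z ≤ wordDist S x z + 2 * δ := by
      rcases h1 with h | h
      · exact h
      · exact absurd ⟨by omega, h⟩ h2
    have h4 := geod_le hγ (show k - 1 ≤ k by omega) hk
    have := wd_tri hS x (γ (k-1)) (γ k)
    have := wd_tri hS (γ k) (γ (k-1)) z
    have := wd_comm hS (γ k) (γ (k-1))
    omega

theorem four_point (hS : IsGenSet S) {δ : ℕ} (hd : IsDeltaHyperbolic S δ) :
    FP S (4 * δ + 4) := by
  intro x y z w
  obtain ⟨γ, hγ, h0, hn⟩ := exists_geod hS x y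
  obtain ⟨k, hk, hk1, hk2⟩ := center hS hd hγ h0 hn z
  obtain ⟨l, hl, hl1, hl2⟩ := center hS hd hγ h0 hn w
  have a1 := geod_le hγ (Nat.zero_le k) hk
  have a2 := geod_le hγ hk le_rfl
  have a3 := geod_le hγ (Nat.zero_le l) hl
  have a4 := geod_le hγ hl le_rfl
  rw [h0] at a1 a3
  rw [hn] at a2 a4
  have t1 := wd_tri hS z (γ k) w
  have t2 := wd_tri hS (γ k) (γ l) w
  have c1 := wd_comm hS z (γ k)
  have c2 := wd_comm hS w (γ l)
  have c3 := wd_comm hS y z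
  have c4 := wd_comm hS y w
  rcases le_total k l with h | h
  · have := geod_le hγ h hl
    right; omega
  · have := geod_le hγ h hk
    have := wd_comm hS (γ k) (γ l)
    left; omega

/-- A `K`-fat tripod centred at `1` with legs at least `L`. -/
def Tripod (S : Set G) (K L : ℕ) : Prop := ∃ a b c : G,
  L ≤ wordDist S 1 a ∧ L ≤ wordDist S 1 b ∧ L ≤ wordDist S 1 c ∧
  wordDist S 1 a + wordDist S 1 b ≤ wordDist S a b + K ∧
  wordDist S 1 b + wordDist S 1 c ≤ wordDist S b c + K ∧
  wordDist S 1 a + wordDist S 1 c ≤ wordDist S a c + K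

theorem gromov_move (hS : IsGenSet S) {D K M : ℕ} (hD : FP S D) {g : G}
    (hM : ∀ x, wordDist S x (g * x) ≤ M) {a b : G}
    (ha : K + 2 * M + 2 * D + 1 ≤ wordDist S 1 a) (hb : K + 2 * M + 2 * D + 1 ≤ wordDist S 1 b)
    (hab : wordDist S 1 a + wordDist S 1 b ≤ wordDist S a b + K) :
    wordDist S g a + wordDist S g b ≤ wordDist S a b + (K + 2 * D) := by
  have e1 : wordDist S g (g * a) = wordDist S 1 a := by simpa using wd_left (S := S) g 1 a
  have e2 : wordDist S g (g * b) = wordDist S 1 b := by simpa using wd_left (S := S) g 1 b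
  have e3 : wordDist S (g * a) (g * b) = wordDist S a b := wd_left g a b
  have m1 := hM a
  have m2 := hM b
  have t1 := wd_tri hS g a (g * a)
  have t2 := wd_tri hS g b (g * b)
  have f1 := hD g a (g * a) (g * b)
  have f2 := hD g b (g * b) a
  have c1 := wd_comm hS (g * b) a
  have c2 := wd_comm hS b a
  omega

theorem step1 (hS : IsGenSet S) {D K : ℕ} (hD : FP S D) (hT : ∀ L, Tripod S K L) {g : G} {M : ℕ}
    (hM : ∀ x, wordDist S x (g * x) ≤ M) : wordDist S 1 g ≤ 4 * K + 8 * D := by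
  obtain ⟨a, b, c, ha, hb, hc, hab, hbc, hac⟩ := hT (K + 2 * M + 2 * D + 1)
  have p1 := gromov_move hS hD hM ha hb hab
  have p2 := gromov_move hS hD hM hb hc hbc
  have p3 := gromov_move hS hD hM ha hc hac
  have q1 := wd_tri hS a 1 b
  have q2 := wd_tri hS b 1 c
  have q3 := wd_tri hS a 1 c
  have r1 := wd_tri hS a g b
  have r2 := wd_tri hS b g c
  have r3 := wd_tri hS a g c
  have f := hD a b 1 g
  have := wd_comm hS a 1
  have := wd_comm hS b 1
  have := wd_comm hS a g
  have := wd_comm hS b g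
  omega

theorem exists_long (hS : IsGenSet S) [Infinite G] (n : ℕ) :
    ∃ γ : ℕ → G, IsGeodesicSegment S γ (2 * n) ∧ γ n = 1 := by
  obtain ⟨x, hx⟩ : ∃ x : G, 2 * n < wordDist S 1 x := by
    by_contra! h
    exact Set.infinite_univ ((ball_finite hS (2 * n)).subset fun x _ => h x)
  obtain ⟨γ, hγ, h0, hn⟩ := exists_geod hS 1 x
  refine ⟨fun i => (γ n)⁻¹ * γ i, ?_, by simp⟩
  intro i j hi hj
  rw [wd_left]
  exact hγ i j (by omega) (by omega)

theorem near_line (hS : IsGenSet S) {D L : ℕ} (hD : FP S D) (hT : ¬ Tripod S (2 * D + 4) L)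
    {n : ℕ} {γ : ℕ → G} (hγ : IsGeodesicSegment S γ (2 * n)) (h1 : γ n = 1) (x : G)
    (hx : wordDist S 1 x + 2 * L + 2 * D + 5 ≤ n) :
    ∃ i ≤ 2 * n, wordDist S x (γ i) ≤ L := by
  have ab := geod_le hγ (Nat.zero_le (2 * n)) le_rfl
  have t1 := wd_tri hS (γ 0) x (γ (2 * n))
  have t2 := wd_tri hS x (γ 0) (γ (2 * n))
  have t3 := wd_tri hS (γ 0) (γ (2 * n)) x
  have c1 := wd_comm hS x (γ 0)
  have c2 := wd_comm hS x (γ (2 * n))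
  obtain ⟨i, hi⟩ : ∃ i, i = (wordDist S x (γ 0) + 2 * n - wordDist S x (γ (2 * n))) / 2 := ⟨_, rfl⟩
  have hi2 : i ≤ 2 * n := by omega
  have pa := geod_le hγ (Nat.zero_le i) hi2
  have pb := geod_le hγ hi2 le_rfl
  have f := hD x (γ i) (γ 0) (γ (2 * n))
  have c3 := wd_comm hS (γ i) (γ 0)
  have c4 := wd_comm hS (γ i) x
  refine ⟨i, hi2, ?_⟩
  by_contra hcon
  have key : i < L ∨ 2 * n - i < L := by
    by_contra! hh
    apply hT
    have ht : ∀ y, wordDist S 1 ((γ i)⁻¹ * y) = wordDist S (γ i) y := by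
      intro y; simp [wordDist]
    refine ⟨(γ i)⁻¹ * γ 0, (γ i)⁻¹ * γ (2 * n), (γ i)⁻¹ * x, ?_⟩
    simp only [ht, wd_left]
    omega
  have e1 : wordDist S 1 (γ i) = if n ≤ i then i - n else n - i := by
    rw [← h1]
    split_ifs with h
    · exact geod_le hγ h hi2
    · rw [wd_comm hS]; exact geod_le hγ (by omega) (by omega)
  have t4 := wd_tri hS 1 x (γ i)
  have t5 := wd_tri hS x 1 (γ 0)
  have t6 := wd_tri hS x 1 (γ (2 * n))
  have c5 := wd_comm hS x 1
  have e2 := geod_le hγ (Nat.zero_le n) (by omega)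
  have e3 := geod_le hγ (show n ≤ 2 * n by omega) le_rfl
  rw [h1] at e2 e3
  have c6 := wd_comm hS 1 (γ 0)
  split_ifs at e1 <;> omega

theorem square_long (hS : IsGenSet S) [Infinite G] {D L M : ℕ} (hD : FP S D)
    (hT : ¬ Tripod S (2 * D + 4) L) {g : G} (hM : ∀ x, wordDist S x (g * x) ≤ M)
    (hg : 4 * L + 2 * D + 1 ≤ wordDist S 1 g) :
    2 * wordDist S 1 g ≤ wordDist S 1 (g ^ 2) + 4 * L := by
  obtain ⟨n, hn⟩ : ∃ n, n = wordDist S 1 g + 2 * L + 2 * D + 5 + M := ⟨_, rfl⟩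
  obtain ⟨γ, hγ, h1⟩ := exists_long hS n
  have ginv : wordDist S 1 g⁻¹ = wordDist S 1 g := by simp [wordDist, wl_inv hS]
  obtain ⟨i, hi, hgi⟩ := near_line hS hD hT hγ h1 g (by omega)
  obtain ⟨j, hj, hgj⟩ := near_line hS hD hT hγ h1 g⁻¹ (by omega)
  have sq : wordDist S g⁻¹ g = wordDist S 1 (g ^ 2) := by simp [wordDist, pow_two]
  have dist : ∀ k ≤ 2 * n, wordDist S 1 (γ k) = if n ≤ k then k - n else n - k := by
    intro k hk
    rw [← h1]
    split_ifs with h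
    · exact geod_le hγ h hk
    · rw [wd_comm hS]; exact geod_le hγ (by omega) (by omega)
  have di := dist i hi
  have dj := dist j hj
  have ti := wd_tri hS 1 (γ i) g
  have tj := wd_tri hS 1 (γ j) g⁻¹
  have ci := wd_comm hS (γ i) g
  have cj := wd_comm hS (γ j) g⁻¹
  have s1 := wd_tri hS (γ i) g (γ j)
  have s2 := wd_tri hS g g⁻¹ (γ j)
  have cg := wd_comm hS g g⁻¹
  have move : ∀ b : G, wordDist S 1 b = n → wordDist S g b + wordDist S 1 g ≤ n + 2 * L →
      wordDist S g⁻¹ b + wordDist S 1 g ≤ n + 2 * L → False := by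
    intro b hb hb1 hb2
    have e1 : wordDist S g (g * b) = wordDist S 1 b := by simpa using wd_left (S := S) g 1 b
    have e2 : wordDist S 1 (g * b) = wordDist S g⁻¹ b := by simp [wordDist]
    have m := hM b
    have f := hD 1 b g (g * b)
    have := wd_comm hS b g
    omega
  rcases le_total n i with hni | hni <;> rcases le_total n j with hnj | hnj
  · exfalso
    have u1 := geod_le hγ hi le_rfl
    have u2 := geod_le hγ hj le_rfl
    have u3 := wd_tri hS g (γ i) (γ (2 * n))
    have u4 := wd_tri hS g⁻¹ (γ j) (γ (2 * n))
    have u5 := dist (2 * n) le_rfl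
    rw [if_pos (by omega)] at di dj u5
    exact move (γ (2 * n)) (by omega) (by omega) (by omega)
  · have u := geod_le hγ (show j ≤ i by omega) hi
    have := wd_comm hS (γ i) (γ j)
    split_ifs at di dj <;> omega
  · have u := geod_le hγ (show i ≤ j by omega) hj
    split_ifs at di dj <;> omega
  · exfalso
    have u1 := geod_le hγ (Nat.zero_le i) hi
    have u2 := geod_le hγ (Nat.zero_le j) hj
    have u3 := wd_tri hS g (γ i) (γ 0)
    have u4 := wd_tri hS g⁻¹ (γ j) (γ 0)
    have v1 := wd_comm hS (γ i) (γ 0)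
    have v2 := wd_comm hS (γ j) (γ 0)
    have u5 := dist 0 (by omega)
    refine move (γ 0) ?_ ?_ ?_ <;> split_ifs at di dj u5 <;> omega

theorem pow_dist (g : G) (m n : ℕ) : wordDist S (g ^ m) (g ^ (m + n)) = wordDist S 1 (g ^ n) := by
  simp [wordDist, pow_add]

theorem pow_grow (hS : IsGenSet S) {D : ℕ} (hD : FP S D) {g : G}
    (hg : wordDist S 1 g + 2 * D + 1 ≤ wordDist S 1 (g ^ 2)) (n : ℕ) :
    wordDist S 1 (g ^ n) + D + 1 ≤ wordDist S 1 (g ^ (n + 1)) := by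
  induction n with
  | zero =>
    have h1 := wd_tri hS 1 g (g ^ 2)
    have h2 := pow_dist (S := S) g 1 1
    simp only [pow_one, Nat.reduceAdd] at h2
    simp only [pow_zero, wd_self, zero_add, pow_one]
    omega
  | succ n ih =>
    have f := hD 1 (g ^ (n + 1)) (g ^ n) (g ^ (n + 2))
    have e1 := pow_dist (S := S) g n 2
    have e2 := pow_dist (S := S) g n 1
    have e3 := pow_dist (S := S) g (n + 1) 1
    have c := wd_comm hS (g ^ n) (g ^ (n + 1))
    simp only [pow_one, add_assoc, Nat.reduceAdd] at *
    omega

theorem pow_add_ge (hS : IsGenSet S) {D : ℕ} (hD : FP S D) {g : G}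
    (hg : wordDist S 1 g + 2 * D + 1 ≤ wordDist S 1 (g ^ 2)) (m n : ℕ) :
    wordDist S 1 (g ^ m) + wordDist S 1 (g ^ (n + 1)) ≤
      wordDist S 1 (g ^ (m + (n + 1))) + wordDist S 1 g + D := by
  have f := hD 1 (g ^ (m + 1)) (g ^ m) (g ^ (m + (n + 1)))
  have e1 := pow_dist (S := S) g m (n + 1)
  have e2 := pow_dist (S := S) g m 1
  have e3 := pow_dist (S := S) g (m + 1) n
  have c := wd_comm hS (g ^ m) (g ^ (m + 1))
  have g1 := pow_grow hS hD hg m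
  have g2 := pow_grow hS hD hg n
  have : m + 1 + n = m + (n + 1) := by omega
  rw [this] at e3
  rw [pow_one] at e2
  omega

theorem pow_proj (hS : IsGenSet S) {D : ℕ} (hD : FP S D) {g : G}
    (hg : wordDist S 1 g + 2 * D + 1 ≤ wordDist S 1 (g ^ 2)) (x : G)
    (hx : wordDist S 1 x ≤ wordDist S g x) (n : ℕ) :
    wordDist S 1 x + wordDist S 1 (g ^ (n + 1)) ≤
      wordDist S x (g ^ (n + 1)) + wordDist S 1 g + D := by
  have f := hD x g 1 (g ^ (n + 1))
  have g2 := pow_grow hS hD hg n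
  have e := pow_dist (S := S) g 1 n
  rw [pow_one, add_comm 1 n] at e
  have := wd_comm hS x 1
  have := wd_comm hS x g
  have := wd_comm hS g 1
  omega

theorem elementary_of (hS : IsGenSet S) {D : ℕ} (hD : FP S D)
    (hT : ∀ K, ∃ L, ¬ Tripod S K L) {g : G}
    (hg : wordDist S 1 g + 2 * D + 1 ≤ wordDist S 1 (g ^ 2)) : IsElementary G := by
  have ginv : ∀ n : ℕ, wordDist S 1 (g⁻¹ ^ n) = wordDist S 1 (g ^ n) := by
    intro n; simp [wordDist, wl_inv hS]
  have ginv1 : wordDist S 1 g⁻¹ = wordDist S 1 g := by simpa using ginv 1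
  have hg' : wordDist S 1 g⁻¹ + 2 * D + 1 ≤ wordDist S 1 (g⁻¹ ^ 2) := by
    rw [ginv, ginv1]; exact hg
  have grow : ∀ n : ℕ, n ≤ wordDist S 1 (g ^ n) := by
    intro n
    induction n with
    | zero => omega
    | succ n ih => have := pow_grow hS hD hg n; omega
  obtain ⟨L, hL⟩ := hT (wordDist S 1 g + D)
  right
  refine ⟨Subgroup.zpowers g, inferInstance, ?_, ?_⟩
  · refine Set.infinite_coe_iff.2 (infinite_zpowers.2 ?_)
    intro hfin
    obtain ⟨n, hn, hn1⟩ := isOfFinOrder_iff_pow_eq_one.1 hfin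
    have := grow n
    rw [hn1, wd_self] at this
    omega
  · have small : ∀ y : G, (∀ h ∈ Subgroup.zpowers g, wordDist S 1 y ≤ wordDist S 1 (h * y)) →
        wordDist S 1 y ≤ L := by
      intro y hy
      by_contra hcon
      apply hL
      have a1 : wordDist S 1 y ≤ wordDist S g y := by
        have := hy g⁻¹ (inv_mem (Subgroup.mem_zpowers g))
        simpa [wordDist] using this
      have a2 : wordDist S 1 y ≤ wordDist S g⁻¹ y := by
        have := hy g (Subgroup.mem_zpowers g)
        simpa [wordDist] using this
      have p1 := pow_proj hS hD hg y a1 L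
      have p2 := pow_proj hS hD hg' y a2 L
      have p3 := pow_add_ge hS hD hg (L + 1) L
      have e : wordDist S (g⁻¹ ^ (L + 1)) (g ^ (L + 1)) = wordDist S 1 (g ^ (L + 1 + (L + 1))) := by
        rw [pow_add g (L + 1) (L + 1)]
        simp only [wordDist, inv_pow, inv_inv, inv_one, one_mul]
      have gr := grow (L + 1)
      have i1 := ginv (L + 1)
      refine ⟨y, g⁻¹ ^ (L + 1), g ^ (L + 1), ?_⟩
      omega
    have hfin : Finite (G ⧸ Subgroup.zpowers g) := by
      have hb := (ball_finite hS L).to_subtype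
      refine Finite.of_surjective
        (fun y : {y : G | wordDist S 1 y ≤ L} => (QuotientGroup.mk (y.1⁻¹) : G ⧸ Subgroup.zpowers g)) ?_
      intro q
      obtain ⟨x, rfl⟩ := QuotientGroup.mk_surjective q
      let f : Subgroup.zpowers g → ℕ := fun h => wordDist S 1 (h.1 * x⁻¹)
      let h0 := Function.argmin f
      refine ⟨⟨h0.1 * x⁻¹, small _ ?_⟩, ?_⟩
      · intro h hh
        have := Function.argmin_le f (⟨h, hh⟩ * h0)
        simpa [f, mul_assoc] using this
      · rw [QuotientGroup.eq]
        simp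
    exact Subgroup.index_ne_zero_of_finite

end Aux

theorem statement_3 {G : Type*} [Group G] (S : Set G) (hGen : IsGenSet S)
    (hHyp : IsHyperbolic S) (hNE : ¬ IsElementary G) :
    {g : G | {h : G | ∃ x : G, h = x⁻¹ * g * x}.Finite}.Finite := by
  obtain ⟨δ, hδ⟩ := hHyp
  have hD := four_point hGen hδ
  generalize 4 * δ + 4 = D at hD
  have hinf : Infinite G := by
    by_contra h
    exact hNE (Or.inl (not_infinite_iff_finite.1 h))
  have disp : ∀ g : G, {h : G | ∃ x : G, h = x⁻¹ * g * x}.Finite →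
      ∃ M, ∀ x, wordDist S x (g * x) ≤ M := by
    intro g hg
    obtain ⟨M, hM⟩ := (hg.image (wordLength S)).bddAbove
    refine ⟨M, fun x => hM ⟨x⁻¹ * g * x, ⟨x, rfl⟩, ?_⟩⟩
    simp [wordDist, mul_assoc]
  by_cases hT : ∃ K, ∀ L, Tripod S K L
  · obtain ⟨K, hT⟩ := hT
    refine (ball_finite hGen (4 * K + 8 * D)).subset ?_
    intro g hg
    obtain ⟨M, hM⟩ := disp g hg
    exact step1 hGen hD hT hM
  · push Not at hT
    obtain ⟨L, hL⟩ := hT (2 * D + 4)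
    by_contra hF
    obtain ⟨g, hgF, hg⟩ : ∃ g : G, {h : G | ∃ x : G, h = x⁻¹ * g * x}.Finite ∧
        4 * L + 2 * D + 1 ≤ wordDist S 1 g := by
      by_contra! h
      exact hF ((ball_finite hGen (4 * L + 2 * D + 1)).subset fun g hg => (h g hg).le)
    obtain ⟨M, hM⟩ := disp g hgF
    have := square_long hGen hD hL hM hg
    exact hNE (elementary_of hGen hD hT (g := g) (by omega))
end

section
/- Let G be a δ-hyperbolic group with finite generating set Σ and let H ⊆ G be a K-quasiconvex subgroup. Then there is a constant C₁ > 0 depending only on δ and K (explicitly C₁ = 4δ + 2K + 8 suffices) such that for every g ∈ G and all x₁, x₂ ∈ gH, d(x₁, x₂) ≤ C₁ + |x₁| + |x₂| − 2σ(g), where σ(g) = min{|gh| : h ∈ H}. -/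
section Helpers

variable {G : Type*} [Group G]

lemma aux_exists_word {S : Set G} (hGen : IsGenSet S) (g : G) :
    ∃ w : List G, (∀ x ∈ w, x ∈ S) ∧ w.length = wordLength S g ∧ w.prod = g := by
  have hne : {n | ∃ w : List G, (∀ x ∈ w, x ∈ S) ∧ w.length = n ∧ w.prod = g}.Nonempty := by
    have hg : g ∈ Subgroup.closure S := by rw [hGen.2.2]; trivial
    rw [← Subgroup.mem_toSubmonoid, Subgroup.closure_toSubmonoid] at hg
    obtain ⟨l, hl, hp⟩ := Submonoid.exists_list_of_mem_closure hg
    refine ⟨l.length, l, fun x hx => ?_, rfl, hp⟩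
    rcases hl x hx with h | h
    · exact h
    · simpa using hGen.2.1 _ h
  exact Nat.sInf_mem hne

lemma aux_le {S : Set G} (w : List G) (hw : ∀ x ∈ w, x ∈ S) :
    wordLength S w.prod ≤ w.length := Nat.sInf_le ⟨w, hw, rfl, rfl⟩

lemma aux_mul {S : Set G} (hGen : IsGenSet S) (a b : G) :
    wordLength S (a * b) ≤ wordLength S a + wordLength S b := by
  obtain ⟨u, hu, hul, hup⟩ := aux_exists_word hGen a
  obtain ⟨v, hv, hvl, hvp⟩ := aux_exists_word hGen b
  have := aux_le (S := S) (u ++ v) (by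
    intro x hx
    rcases List.mem_append.1 hx with h | h
    · exact hu x h
    · exact hv x h)
  rw [List.prod_append, List.length_append, hup, hvp, hul, hvl] at this
  exact this

lemma aux_inv_le {S : Set G} (hGen : IsGenSet S) (a : G) :
    wordLength S a⁻¹ ≤ wordLength S a := by
  obtain ⟨u, hu, hul, hup⟩ := aux_exists_word hGen a
  have := aux_le (S := S) (u.map (·⁻¹)).reverse (by
    intro x hx
    simp only [List.mem_reverse, List.mem_map] at hx
    obtain ⟨y, hy, rfl⟩ := hx
    exact hGen.2.1 _ (hu y hy))
  rw [← List.prod_inv_reverse, hup] at this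
  simpa [hul] using this

lemma aux_symm {S : Set G} (hGen : IsGenSet S) (a b : G) :
    wordDist S a b = wordDist S b a := by
  have key : ∀ a b : G, wordDist S a b ≤ wordDist S b a := by
    intro a b
    have := aux_inv_le hGen (b⁻¹ * a)
    simpa [wordDist] using this
  exact le_antisymm (key a b) (key b a)

lemma aux_tri {S : Set G} (hGen : IsGenSet S) (a b c : G) :
    wordDist S a c ≤ wordDist S a b + wordDist S b c := by
  have := aux_mul hGen (a⁻¹ * b) (b⁻¹ * c)
  simpa [wordDist, mul_assoc] using this

lemma aux_one_dist {S : Set G} (a : G) : wordDist S 1 a = wordLength S a := by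
  simp [wordDist]

lemma aux_geod {S : Set G} (hGen : IsGenSet S) (x y : G) :
    ∃ γ : ℕ → G, IsGeodesicSegment S γ (wordDist S x y) ∧ γ 0 = x ∧ γ (wordDist S x y) = y := by
  obtain ⟨w, hw, hwl, hwp⟩ := aux_exists_word hGen (x⁻¹ * y)
  change w.length = wordDist S x y at hwl
  have h0 : x * (w.take 0).prod = x := by simp
  have hn : x * (w.take (wordDist S x y)).prod = y := by
    rw [← hwl, List.take_length, hwp]; simp
  have hle : ∀ i j, i ≤ j → j ≤ wordDist S x y →
      wordDist S (x * (w.take i).prod) (x * (w.take j).prod) ≤ j - i := by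
    intro i j hij hj
    have e : (x * (w.take i).prod)⁻¹ * (x * (w.take j).prod) = ((w.take j).drop i).prod := by
      have h1 : (w.take j).prod = (w.take i).prod * ((w.take j).drop i).prod := by
        rw [← List.prod_take_mul_prod_drop (w.take j) i, List.take_take, min_eq_left hij]
      rw [h1]; group
    unfold wordDist
    rw [e]
    refine (aux_le (S := S) _ ?_).trans ?_
    · intro z hz
      exact hw z (List.mem_of_mem_take (List.mem_of_mem_drop hz))
    · simp only [List.length_drop, List.length_take]
      omega
  have heq : ∀ i j, i ≤ j → j ≤ wordDist S x y →
      wordDist S (x * (w.take i).prod) (x * (w.take j).prod) = j - i := by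
    intro i j hij hj
    have h1 := hle i j hij hj
    have h2 := hle 0 i (Nat.zero_le _) (hij.trans hj)
    have h3 := hle j _ hj le_rfl
    rw [h0] at h2
    rw [hn] at h3
    have t1 := aux_tri hGen x (x * (w.take i).prod) y
    have t2 := aux_tri hGen (x * (w.take i).prod) (x * (w.take j).prod) y
    omega
  refine ⟨fun i => x * (w.take i).prod, ?_, h0, hn⟩
  intro i j hi hj
  rcases le_total i j with h | h
  · rw [Nat.dist_eq_sub_of_le h]; exact heq i j h hj
  · rw [Nat.dist_eq_sub_of_le_right h, aux_symm hGen]; exact heq j i h hi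

end Helpers

/-- (Lemma 5A) For a `δ`-hyperbolic `G` and `K`-quasiconvex `H`:
for all `x₁, x₂` in a coset `gH`, `d(x₁,x₂) ≤ C₁ + |x₁| + |x₂| - 2σ(g)` with
`C₁ = 4δ + 2K + 8` and `σ(g) = min {|gh| : h ∈ H}`. -/
theorem statement_7 {G : Type*} [Group G] (S : Set G) (hGen : IsGenSet S) (δ K : ℕ)
    (hδ : IsDeltaHyperbolic S δ) (H : Subgroup G) (hQC : IsQuasiconvex S H K)
    (g x₁ x₂ : G) (hx₁ : ∃ h ∈ H, x₁ = g * h) (hx₂ : ∃ h ∈ H, x₂ = g * h) :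
    (wordDist S x₁ x₂ : ℤ) ≤ (4 * δ + 2 * K + 8 : ℤ) + (wordLength S x₁ : ℤ) +
      (wordLength S x₂ : ℤ) -
      2 * ((sInf {n : ℕ | ∃ h ∈ H, wordLength S (g * h) = n} : ℕ) : ℤ) := by
  obtain ⟨γ₁, hg₁, ha₁, hb₁⟩ := aux_geod hGen x₁ 1
  obtain ⟨γ₂, hg₂, ha₂, hb₂⟩ := aux_geod hGen 1 x₂
  obtain ⟨γ₃, hg₃, ha₃, hb₃⟩ := aux_geod hGen x₁ x₂
  have hl₁ : wordDist S x₁ 1 = wordLength S x₁ := by rw [aux_symm hGen, aux_one_dist]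
  have hl₂ : wordDist S 1 x₂ = wordLength S x₂ := aux_one_dist x₂
  rw [hl₁] at hg₁ hb₁
  rw [hl₂] at hg₂ hb₂
  set n := wordDist S x₁ x₂ with hn
  set σ := sInf {n : ℕ | ∃ h ∈ H, wordLength S (g * h) = n} with hσ
  -- distances along the side from `x₁` to `x₂`
  have hd₁ : ∀ k ≤ n, wordDist S x₁ (γ₃ k) = k := by
    intro k hk
    have := hg₃ 0 k (Nat.zero_le _) hk
    rw [ha₃, Nat.dist_eq_sub_of_le (Nat.zero_le _)] at this
    simpa using this
  have hd₂ : ∀ k ≤ n, wordDist S (γ₃ k) x₂ = n - k := by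
    intro k hk
    have := hg₃ k n hk le_rfl
    rwa [hb₃, Nat.dist_eq_sub_of_le hk] at this
  -- quasiconvexity of the coset
  have hq : ∀ k ≤ n, σ ≤ wordLength S (γ₃ k) + K := by
    intro k hk
    obtain ⟨h, hh, hhK⟩ := hQC (fun i => g⁻¹ * γ₃ i) n
      (by
        intro i j hi hj
        rw [← hg₃ i j hi hj]
        unfold wordDist
        congr 1
        group)
      (by
        obtain ⟨h, hh, e⟩ := hx₁
        simp only [ha₃, e]
        simpa using hh)
      (by
        obtain ⟨h, hh, e⟩ := hx₂
        simp only [hb₃, e]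
        simpa using hh) k hk
    have e : wordDist S (g⁻¹ * γ₃ k) h = wordDist S (γ₃ k) (g * h) := by
      unfold wordDist
      congr 1
      group
    rw [e] at hhK
    have h1 : σ ≤ wordLength S (g * h) := Nat.sInf_le ⟨h, hh, rfl⟩
    have h2 := aux_tri hGen 1 (γ₃ k) (g * h)
    rw [aux_one_dist, aux_one_dist] at h2
    omega
  -- every point of the third side is close to one of the other two sides
  have hAB : ∀ k ≤ n, wordLength S (γ₃ k) + k ≤ wordLength S x₁ + 2 * δ ∨
      wordLength S (γ₃ k) + (n - k) ≤ wordLength S x₂ + 2 * δ := by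
    intro k hk
    obtain ⟨i, ⟨hi, hd⟩ | ⟨hi, hd⟩⟩ := hδ γ₁ γ₂ γ₃ _ _ _ hg₁ hg₂ hg₃ (ha₁.trans ha₃.symm)
      (hb₁.trans ha₂.symm) (hb₂.trans hb₃.symm) k hk
    · left
      have e1 := hg₁ 0 i (Nat.zero_le _) hi
      have e2 := hg₁ i _ hi le_rfl
      rw [ha₁, Nat.dist_eq_sub_of_le (Nat.zero_le _)] at e1
      rw [hb₁, Nat.dist_eq_sub_of_le hi] at e2
      have t1 := aux_tri hGen x₁ (γ₁ i) (γ₃ k)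
      have t2 := aux_tri hGen (γ₃ k) (γ₁ i) 1
      rw [hd₁ k hk, aux_symm hGen (γ₁ i)] at t1
      rw [aux_symm hGen (γ₃ k) 1, aux_one_dist] at t2
      omega
    · right
      have e1 := hg₂ 0 i (Nat.zero_le _) hi
      have e2 := hg₂ i _ hi le_rfl
      rw [ha₂, Nat.dist_eq_sub_of_le (Nat.zero_le _)] at e1
      rw [hb₂, Nat.dist_eq_sub_of_le hi] at e2
      have t1 := aux_tri hGen 1 (γ₂ i) (γ₃ k)
      have t2 := aux_tri hGen (γ₃ k) (γ₂ i) x₂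
      rw [aux_one_dist, aux_symm hGen (γ₂ i)] at t1
      rw [hd₂ k hk] at t2
      omega
  by_contra hcon
  have hall : ∀ k ≤ n, wordLength S (γ₃ k) + k ≤ wordLength S x₁ + 2 * δ := by
    intro k
    induction k with
    | zero => intro _; rw [ha₃]; omega
    | succ k ih =>
      intro hk
      have hA := ih (by omega)
      rcases hAB (k + 1) hk with h | h
      · exact h
      · exfalso
        have q1 := hq k (by omega)
        have q2 := hq (k + 1) hk
        omega
  have hA := hall n le_rfl
  have q := hq n le_rfl
  rw [hb₃] at hA q
  omega
end
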